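/- Let k ≥ 1 and let R : Fin k → ℝ → Matrix (Fin 3) (Fin 3) ℝ be a family of matrix-valued functions such that: each R j is differentiable at t₀ with derivative S(ω j) * (R j t₀), where S(ω) denotes the cross-product matrix of ω j ∈ ℝ³; each R j t₀ is orthogonal with determinant 1; and the ordered product (R 0 t) * (R 1 t) * ⋯ * (R (k−1) t) equals the identity matrix for all t in a neighborhood of t₀. Then ∑_{j=0}^{k−1} ((R 0 t₀) * ⋯ * (R (j−1) t₀)).mulVec (ω j) = 0 (where for j = 0 the empty product is the identity). -/

import Mathlib

open Matrix Filter

attribute [local instance] Matrix.normedAddCommGroup Matrix.normedSpace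

/-- The cross-product (skew-symmetric) matrix of a vector `ω ∈ ℝ³`. -/
def crossMatrix (ω : Fin 3 → ℝ) : Matrix (Fin 3) (Fin 3) ℝ :=
  Matrix.of ![![0, -ω 2, ω 1], ![ω 2, 0, -ω 0], ![-ω 1, ω 0, 0]]

theorem transpose_mul_crossMatrix_mulVec_mul (A : Matrix (Fin 3) (Fin 3) ℝ) (v : Fin 3 → ℝ) :
    Aᵀ * crossMatrix (A *ᵥ v) * A = A.det • crossMatrix v := by
  ext i j
  fin_cases i <;> fin_cases j <;>
    simp [crossMatrix, Matrix.mul_apply, Matrix.mulVec, dotProduct, Fin.sum_univ_three,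
      Matrix.det_fin_three] <;> ring

theorem crossMatrix_mulVec_mul {A : Matrix (Fin 3) (Fin 3) ℝ} (hA : Aᵀ * A = 1)
    (hdet : A.det = 1) (v : Fin 3 → ℝ) :
    crossMatrix (A *ᵥ v) * A = A * crossMatrix v := by
  rw [← one_smul ℝ (crossMatrix v), ← hdet, ← transpose_mul_crossMatrix_mulVec_mul,
    Matrix.mul_assoc, ← Matrix.mul_assoc A, mul_eq_one_comm.mp hA, Matrix.one_mul]

theorem crossMatrix_add (v w : Fin 3 → ℝ) :
    crossMatrix (v + w) = crossMatrix v + crossMatrix w := by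
  ext i j
  fin_cases i <;> fin_cases j <;> simp [crossMatrix] <;> ring

theorem crossMatrix_zero : crossMatrix 0 = 0 := by
  ext i j
  fin_cases i <;> fin_cases j <;> simp [crossMatrix]

theorem eq_zero_of_crossMatrix_eq_zero {v : Fin 3 → ℝ} (h : crossMatrix v = 0) : v = 0 := by
  ext i
  fin_cases i
  · simpa [crossMatrix] using congrFun (congrFun h 2) 1
  · simpa [crossMatrix] using congrFun (congrFun h 0) 2
  · simpa [crossMatrix] using congrFun (congrFun h 1) 0

theorem hasDerivAt_matrix_mul {n : Type*} [Fintype n] {A B : ℝ → Matrix n n ℝ}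
    {A' B' : Matrix n n ℝ} {t : ℝ} (hA : HasDerivAt A A' t) (hB : HasDerivAt B B' t) :
    HasDerivAt (fun s => A s * B s) (A' * B t + A t * B') t := by
  refine hasDerivAt_pi.mpr fun i => hasDerivAt_pi.mpr fun j => ?_
  simp only [Matrix.mul_apply, Matrix.add_apply, ← Finset.sum_add_distrib]
  exact HasDerivAt.fun_sum fun l _ =>
    (hasDerivAt_pi.mp (hasDerivAt_pi.mp hA i) l).mul (hasDerivAt_pi.mp (hasDerivAt_pi.mp hB l) j)

/-- The angular velocity of a product of rotations is the sum of the angular velocities of the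
factors, each transported by the preceding rotations. -/
theorem hasDerivAt_prod_ofFn_rotation (k : ℕ) (R : Fin k → ℝ → Matrix (Fin 3) (Fin 3) ℝ) (t₀ : ℝ)
    (ω : Fin k → Fin 3 → ℝ)
    (hderiv : ∀ j, HasDerivAt (R j) (crossMatrix (ω j) * R j t₀) t₀)
    (horth : ∀ j, (R j t₀)ᵀ * R j t₀ = 1) (hdet : ∀ j, (R j t₀).det = 1) :
    HasDerivAt (fun t => (List.ofFn fun j : Fin k => R j t).prod)
      (crossMatrix (∑ j : Fin k,
        ((List.ofFn fun i : Fin k => R i t₀).take j.val).prod.mulVec (ω j)) *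
        (List.ofFn fun j : Fin k => R j t₀).prod) t₀ := by
  induction k with
  | zero =>
    simp only [Finset.univ_eq_empty, Finset.sum_empty, crossMatrix_zero, Matrix.zero_mul]
    exact hasDerivAt_const t₀ 1
  | succ k ih =>
    have h := hasDerivAt_matrix_mul (hderiv 0) (ih (fun j => R j.succ) (fun j => ω j.succ)
      (fun j => hderiv j.succ) (fun j => horth j.succ) (fun j => hdet j.succ))
    simp only [List.ofFn_succ, List.prod_cons, Fin.sum_univ_succ, Fin.val_zero, List.take_zero,
      List.prod_nil, Matrix.one_mulVec, Fin.val_succ, List.take_succ_cons, ← Matrix.mulVec_mulVec,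
      ← Matrix.mulVec_sum, crossMatrix_add]
    rwa [Matrix.add_mul, ← Matrix.mul_assoc (crossMatrix (R 0 t₀ *ᵥ _)),
      crossMatrix_mulVec_mul (horth 0) (hdet 0), Matrix.mul_assoc (R 0 t₀),
      ← Matrix.mul_assoc (crossMatrix (ω 0))]

theorem vertex_equation (k : ℕ) (hk : 1 ≤ k)
    (R : Fin k → ℝ → Matrix (Fin 3) (Fin 3) ℝ) (t₀ : ℝ)
    (ω : Fin k → Fin 3 → ℝ)
    (hderiv : ∀ j, HasDerivAt (R j) (crossMatrix (ω j) * R j t₀) t₀)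
    (horth : ∀ j, (R j t₀)ᵀ * R j t₀ = 1) (hdet : ∀ j, (R j t₀).det = 1)
    (hclosure : ∀ᶠ t in nhds t₀, (List.ofFn fun j : Fin k => R j t).prod = 1) :
    ∑ j : Fin k,
      ((List.ofFn fun i : Fin k => R i t₀).take j.val).prod.mulVec (ω j) = 0 := by
  have h := hasDerivAt_prod_ofFn_rotation k R t₀ ω hderiv horth hdet
  rw [hclosure.self_of_nhds, Matrix.mul_one] at h
  exact eq_zero_of_crossMatrix_eq_zero
    (h.unique ((hasDerivAt_const t₀ 1).congr_of_eventuallyEq hclosure))
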